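/- Let λ ∈ ℝ, n a natural number, and let y₀ : ℝ → ℝ be a smooth function satisfying y₀'' = λ·y₀ on ℝ. On the interval I = (0, ∞) define g₀ = y₀ and g_{j+1}(x) = g_j'(x)/sinh(x) for 0 ≤ j ≤ n, and set y_n(x) = sinh(x)^{n+1}·g_{n+1}(x). Then y_n is twice differentiable on I and satisfies y_n''(x) − (λ + n(n+1)/sinh²(x))·y_n(x) = 0 for all x ∈ I. -/

import Mathlib

open Real Set

/-- The operator `(1 / sinh x) D` preserves smoothness on `(0, ∞)`. -/
lemma ContDiffOn.deriv_div_sinh {g : ℝ → ℝ} (hg : ContDiffOn ℝ (⊤ : ℕ∞) g (Ioi 0)) :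
    ContDiffOn ℝ (⊤ : ℕ∞) (fun s => deriv g s / Real.sinh s) (Ioi 0) :=
  (hg.deriv_of_isOpen isOpen_Ioi (by simp)).div Real.contDiff_sinh.contDiffOn
    fun _ hx => (Real.sinh_pos_iff.2 hx).ne'

lemma ContDiffOn.hasDerivAt_deriv_Ioi {g : ℝ → ℝ} {a x : ℝ}
    (hg : ContDiffOn ℝ (⊤ : ℕ∞) g (Ioi a)) (hx : a < x) :
    HasDerivAt g (deriv g x) x ∧ HasDerivAt (deriv g) (deriv (deriv g) x) x := by
  have hn : Ioi a ∈ nhds x := Ioi_mem_nhds hx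
  have hg' : ContDiffOn ℝ (⊤ : ℕ∞) (deriv g) (Ioi a) :=
    hg.deriv_of_isOpen isOpen_Ioi (by simp)
  exact ⟨((hg.contDiffAt hn).differentiableAt (by simp)).hasDerivAt,
    ((hg'.contDiffAt hn).differentiableAt (by simp)).hasDerivAt⟩

/-- If `g'' = -a coth(x) g' + b g` on `(0, ∞)`, then `h = g' / sinh` satisfies
`h'' = -(a + 2) coth(x) h' + (b - 1 - a) h` there. -/
lemma sinh_mul_deriv_deriv_deriv_div_sinh {g : ℝ → ℝ} {a b : ℝ}
    (hg : ContDiffOn ℝ (⊤ : ℕ∞) g (Ioi 0))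
    (hode : ∀ x ∈ Ioi (0 : ℝ), Real.sinh x * deriv (deriv g) x =
      -a * Real.cosh x * deriv g x + b * Real.sinh x * g x) {h : ℝ → ℝ}
    (hh : h = fun s => deriv g s / Real.sinh s) :
    ∀ x ∈ Ioi (0 : ℝ), Real.sinh x * deriv (deriv h) x =
      -(a + 2) * Real.cosh x * deriv h x + (b - 1 - a) * Real.sinh x * h x := by
  have hhs : ContDiffOn ℝ (⊤ : ℕ∞) h (Ioi 0) := hh ▸ hg.deriv_div_sinh
  have hgh : ∀ x ∈ Ioi (0 : ℝ), deriv g x = Real.sinh x * h x := fun x hx => by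
    rw [hh, mul_div_cancel₀ _ (Real.sinh_pos_iff.2 hx).ne']
  have hfirst : ∀ x ∈ Ioi (0 : ℝ),
      Real.sinh x * deriv h x + (1 + a) * (Real.cosh x * h x) - b * g x = 0 := by
    intro x hx
    have hd : deriv (deriv g) x = Real.cosh x * h x + Real.sinh x * deriv h x := by
      rw [Filter.EventuallyEq.deriv_eq
        (Filter.eventuallyEq_of_mem (Ioi_mem_nhds hx) hgh :
          deriv g =ᶠ[nhds x] fun t => Real.sinh t * h t)]
      exact ((Real.hasDerivAt_sinh x).mul (hhs.hasDerivAt_deriv_Ioi hx).1).deriv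
    have ho := hode x hx
    rw [hd, hgh x hx] at ho
    refine mul_left_cancel₀ (Real.sinh_pos_iff.2 hx).ne' ?_
    linear_combination ho
  intro x hx
  obtain ⟨h₁, h₂⟩ := hhs.hasDerivAt_deriv_Ioi hx
  have hd := (((Real.hasDerivAt_sinh x).mul h₂).add
    (((Real.hasDerivAt_cosh x).mul h₁).const_mul (1 + a))).sub
    ((hg.hasDerivAt_deriv_Ioi hx).1.const_mul b)
  have hz := hd.unique ((hasDerivAt_const x (0 : ℝ)).congr_of_eventuallyEq
    (Filter.eventuallyEq_of_mem (Ioi_mem_nhds hx) hfirst))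
  rw [hgh x hx] at hz
  linear_combination hz

/-- The iterates `g` of `(1 / sinh x) D` on a solution of `y'' = lam y` satisfy
`g'' = -2 m coth(x) g' + (lam - m²) g` on `(0, ∞)`. -/
lemma iterate_deriv_div_sinh_ode {lam : ℝ} {y₀ : ℝ → ℝ} (hy₀ : ContDiff ℝ (⊤ : ℕ∞) y₀)
    (hode : ∀ x : ℝ, deriv (deriv y₀) x = lam * y₀ x) (m : ℕ) {g : ℝ → ℝ}
    (hg : g = (fun g : ℝ → ℝ => fun s : ℝ => deriv g s / Real.sinh s)^[m] y₀) :
    ContDiffOn ℝ (⊤ : ℕ∞) g (Ioi 0) ∧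
      ∀ x ∈ Ioi (0 : ℝ), Real.sinh x * deriv (deriv g) x =
        -(2 * m) * Real.cosh x * deriv g x + (lam - (m : ℝ) ^ 2) * Real.sinh x * g x := by
  induction m generalizing g with
  | zero =>
    subst hg
    refine ⟨hy₀.contDiffOn, fun x _ => ?_⟩
    simp only [hode, Nat.cast_zero]
    ring
  | succ m ih =>
    obtain ⟨hs, ho⟩ := ih rfl
    rw [Function.iterate_succ_apply'] at hg
    refine ⟨hg ▸ hs.deriv_div_sinh, fun x hx => ?_⟩
    have := sinh_mul_deriv_deriv_deriv_div_sinh hs ho hg x hx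
    push_cast
    linear_combination this

/-- The product `sinhⁿ⁺¹ g` of a solution `g` of
`g'' = -2 (n + 1) coth(x) g' + (lam - (n + 1)²) g` solves the Schrödinger equation. -/
lemma sinh_pow_mul_schrodinger {lam : ℝ} {g : ℝ → ℝ} (n : ℕ)
    (hg : ContDiffOn ℝ (⊤ : ℕ∞) g (Ioi 0))
    (hode : ∀ x ∈ Ioi (0 : ℝ), Real.sinh x * deriv (deriv g) x =
      -(2 * ((n : ℝ) + 1)) * Real.cosh x * deriv g x +
        (lam - ((n : ℝ) + 1) ^ 2) * Real.sinh x * g x) {x : ℝ} (hx : 0 < x) :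
    deriv (deriv fun t => Real.sinh t ^ (n + 1) * g t) x
      - (lam + (n : ℝ) * ((n : ℝ) + 1) / Real.sinh x ^ 2) *
        (Real.sinh x ^ (n + 1) * g x) = 0 := by
  have hd : ∀ t ∈ Ioi (0 : ℝ), deriv (fun t => Real.sinh t ^ (n + 1) * g t) t =
      (n + 1) * (Real.sinh t ^ n * Real.cosh t * g t) + Real.sinh t ^ (n + 1) * deriv g t := by
    intro t ht
    rw [(((Real.hasDerivAt_sinh t).fun_pow (n + 1)).fun_mul
      (hg.hasDerivAt_deriv_Ioi ht).1).deriv]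
    push_cast
    ring
  obtain ⟨h₁, h₂⟩ := hg.hasDerivAt_deriv_Ioi hx
  have hsinh := Real.hasDerivAt_sinh x
  rw [Filter.EventuallyEq.deriv_eq (Filter.eventuallyEq_of_mem (Ioi_mem_nhds hx) hd),
    (((((hsinh.fun_pow n).fun_mul (Real.hasDerivAt_cosh x)).fun_mul h₁).const_mul
      ((n : ℝ) + 1)).fun_add ((hsinh.fun_pow (n + 1)).fun_mul h₂)).deriv]
  have hs : Real.sinh x ≠ 0 := (Real.sinh_pos_iff.2 hx).ne'
  have ho := hode x hx
  have hc := Real.cosh_sq x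
  rcases n with _ | k
  · simp only [Nat.cast_zero] at ho ⊢
    simp
    linear_combination ho
  · simp only [Nat.add_sub_cancel]
    push_cast at ho ⊢
    field_simp
    linear_combination Real.sinh x ^ (k + 3) * ho +
      (k + 1) * (k + 2) * Real.sinh x ^ (k + 2) * g x * hc

/-- The function y_n = sinh^{n+1}(x)·((1/sinh x)D)^{n+1} y₀ solves the
Schrödinger equation y'' − (λ + n(n+1)/sinh²x)y = 0 on (0, ∞), where
y₀'' = λy₀. -/
theorem stmt15 (lam : ℝ) (n : ℕ) (y₀ : ℝ → ℝ)
    (hy₀ : ContDiff ℝ (⊤ : ℕ∞) y₀)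
    (hode : ∀ x : ℝ, deriv (deriv y₀) x = lam * y₀ x) :
    (∀ x ∈ Ioi (0 : ℝ),
      DifferentiableAt ℝ
        (fun t : ℝ => Real.sinh t ^ (n + 1) *
          ((fun g : ℝ → ℝ => fun s : ℝ => deriv g s / Real.sinh s)^[n + 1] y₀) t) x) ∧
    (∀ x ∈ Ioi (0 : ℝ),
      DifferentiableAt ℝ
        (deriv (fun t : ℝ => Real.sinh t ^ (n + 1) *
          ((fun g : ℝ → ℝ => fun s : ℝ => deriv g s / Real.sinh s)^[n + 1] y₀) t)) x) ∧
    (∀ x ∈ Ioi (0 : ℝ),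
      deriv (deriv (fun t : ℝ => Real.sinh t ^ (n + 1) *
          ((fun g : ℝ → ℝ => fun s : ℝ => deriv g s / Real.sinh s)^[n + 1] y₀) t)) x
        - (lam + (n : ℝ) * ((n : ℝ) + 1) / Real.sinh x ^ 2) *
          (Real.sinh x ^ (n + 1) *
            ((fun g : ℝ → ℝ => fun s : ℝ => deriv g s / Real.sinh s)^[n + 1] y₀) x) = 0) := by
  obtain ⟨hg, ho⟩ := iterate_deriv_div_sinh_ode hy₀ hode (n + 1) rfl
  push_cast at ho
  have hs := (Real.contDiff_sinh.pow (n + 1)).contDiffOn.mul hg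
  exact ⟨fun x hx => (hs.hasDerivAt_deriv_Ioi hx).1.differentiableAt,
    fun x hx => (hs.hasDerivAt_deriv_Ioi hx).2.differentiableAt,
    fun x hx => sinh_pow_mul_schrodinger n hg ho hx⟩
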